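/- For every non-negative integer m and integer k ≥ 2, 1/π = [(1/2)_{m+k} / 2^(2m)] · [(2m)!/m!] · Σ_{n=0}^∞ [(m+1/2)_n · ⟨m−1/2⟩_n · (m+1/2)_{k+n} · (k+m+2n+1/2)] / [n! · (k+n)! · (2m+k+n)!]. -/

import Mathlib

/-- Rising factorial (Pochhammer symbol) `(x)_n`. -/
def risingFac (x : ℝ) (n : ℕ) : ℝ := ∏ i ∈ Finset.range n, (x + i)

/-- Falling factorial `⟨x⟩_n = x(x-1)⋯(x-n+1)`. -/
def fallingFac (x : ℝ) (n : ℕ) : ℝ := ∏ i ∈ Finset.range n, (x - i)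

open Filter Topology Finset

theorem risingFac_succ (x : ℝ) (n : ℕ) : risingFac x (n + 1) = risingFac x n * (x + n) :=
  prod_range_succ _ _

theorem fallingFac_succ (x : ℝ) (n : ℕ) : fallingFac x (n + 1) = fallingFac x n * (x - n) :=
  prod_range_succ _ _

theorem risingFac_add (x : ℝ) (m n : ℕ) :
    risingFac x (m + n) = risingFac x m * risingFac (x + m) n := by
  simp [risingFac, prod_range_add, add_assoc]

theorem risingFac_pos {x : ℝ} (hx : 0 < x) (n : ℕ) : 0 < risingFac x n :=
  prod_pos fun i _ => by positivity

theorem risingFac_half (m : ℕ) :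
    risingFac (1 / 2) m = ((2 * m).factorial : ℝ) / (m.factorial : ℝ) / 2 ^ (2 * m) := by
  induction m with
  | zero => simp [risingFac]
  | succ m ih =>
    rw [risingFac_succ, ih, show 2 * (m + 1) = 2 * m + 1 + 1 by ring]
    simp only [Nat.factorial_succ]
    push_cast
    field_simp
    ring

/-- The summand of the series, normalised so that its sum is `1 / π`, without its linear factor. -/
noncomputable def wzKernel (m k n : ℕ) : ℝ :=
  risingFac (1 / 2) (m + k) * risingFac (1 / 2) m *
    (risingFac ((m : ℝ) + 1 / 2) n * fallingFac ((m : ℝ) - 1 / 2) n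
      * risingFac ((m : ℝ) + 1 / 2) (k + n) /
    ((n.factorial : ℝ) * ((k + n).factorial : ℝ) * ((2 * m + k + n).factorial : ℝ)))

/-- The summand of the series, normalised so that its sum is `1 / π`. -/
noncomputable def wzTerm (m k n : ℕ) : ℝ := wzKernel m k n * ((k : ℝ) + m + 2 * n + 1 / 2)

theorem wzKernel_succ_left (m k n : ℕ) :
    wzKernel m (k + 1) n = wzKernel m k n *
      (((m : ℝ) + k + 1 / 2) * (m + k + n + 1 / 2) / ((k + n + 1) * (2 * m + k + n + 1))) := by
  unfold wzKernel
  rw [show m + (k + 1) = m + k + 1 by ring, show k + 1 + n = k + n + 1 by ring,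
    show 2 * m + (k + 1) + n = 2 * m + k + n + 1 by ring]
  simp only [risingFac_succ, Nat.factorial_succ]
  push_cast
  field_simp
  ring

theorem wzKernel_succ_right (m k n : ℕ) :
    wzKernel m k (n + 1) = wzKernel m k n *
      (((m : ℝ) + n + 1 / 2) * (m - n - 1 / 2) * (m + k + n + 1 / 2) /
        ((n + 1) * (k + n + 1) * (2 * m + k + n + 1))) := by
  unfold wzKernel
  simp only [← add_assoc, risingFac_succ, fallingFac_succ, Nat.factorial_succ]
  push_cast
  field_simp
  ring

theorem wzTerm_succ_left_sub (m k n : ℕ) :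
    wzTerm m (k + 1) n - wzTerm m k n =
      ((n + 1 : ℕ) : ℝ) * wzKernel m k (n + 1) - n * wzKernel m k n := by
  unfold wzTerm
  rw [wzKernel_succ_left, wzKernel_succ_right]
  push_cast
  field_simp
  ring

theorem sum_wzTerm_succ_left (m k N : ℕ) :
    ∑ n ∈ range N, wzTerm m (k + 1) n = ∑ n ∈ range N, wzTerm m k n + N * wzKernel m k N := by
  rw [← sub_eq_iff_eq_add', ← sum_sub_distrib]
  simp only [wzTerm_succ_left_sub]
  rw [sum_range_sub (fun n : ℕ => (n : ℝ) * wzKernel m k n)]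
  simp

theorem abs_wzKernel_succ_le (m k n : ℕ) (hk : 2 ≤ k) (hm : m ≤ n) (hn : 1 ≤ n) :
    |wzKernel m k (n + 1)| * ((n + 1) * (n + 2)) ≤ |wzKernel m k n| * (n * (n + 1)) := by
  have hk' : (2 : ℝ) ≤ k := by exact_mod_cast hk
  have hm' : (m : ℝ) ≤ n := by exact_mod_cast hm
  have hn' : (1 : ℝ) ≤ n := by exact_mod_cast hn
  have hm0 : (0 : ℝ) ≤ m := m.cast_nonneg
  rw [wzKernel_succ_right, abs_mul, mul_assoc]
  refine mul_le_mul_of_nonneg_left ?_ (abs_nonneg _)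
  rw [abs_div, abs_mul, abs_mul, abs_of_nonneg (by positivity : (0 : ℝ) ≤ m + n + 1 / 2),
    abs_of_nonpos (by linarith : (m : ℝ) - n - 1 / 2 ≤ 0),
    abs_of_nonneg (by positivity : (0 : ℝ) ≤ m + k + n + 1 / 2),
    abs_of_nonneg (by positivity : (0 : ℝ) ≤ (n + 1) * (k + n + 1) * (2 * m + k + n + 1)),
    div_mul_eq_mul_div, div_le_iff₀ (by positivity)]
  have h1 : ((m : ℝ) + n + 1 / 2) * -(m - n - 1 / 2) * (n + 2) ≤ n * (n + 1) * (k + n + 1) := by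
    calc ((m : ℝ) + n + 1 / 2) * -(m - n - 1 / 2) * (n + 2)
        ≤ (n + 1 / 2) ^ 2 * (n + 2) := by gcongr; nlinarith
      _ ≤ n * (n + 1) * (2 + n + 1) := by nlinarith
      _ ≤ n * (n + 1) * (k + n + 1) := by gcongr
  calc ((m : ℝ) + n + 1 / 2) * -(m - n - 1 / 2) * (m + k + n + 1 / 2) * ((n + 1) * (n + 2))
      = ((m : ℝ) + n + 1 / 2) * -(m - n - 1 / 2) * (n + 2)
          * ((m + k + n + 1 / 2) * (n + 1)) := by ring
    _ ≤ n * (n + 1) * (k + n + 1) * ((2 * m + k + n + 1) * (n + 1)) := by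
        gcongr
        · linarith
        · norm_num
    _ = _ := by ring

theorem tendsto_mul_wzKernel (m k : ℕ) (hk : 2 ≤ k) :
    Tendsto (fun N : ℕ => (N : ℝ) * wzKernel m k N) atTop (𝓝 0) := by
  set C := |wzKernel m k (m + 1)| * (((m + 1 : ℕ) : ℝ) * ((m + 1 : ℕ) + 1))
  have hC : ∀ n, m + 1 ≤ n → |wzKernel m k n| * ((n : ℝ) * (n + 1)) ≤ C := by
    intro n hn
    induction n, hn using Nat.le_induction with
    | base => exact le_rfl
    | succ n hn ih =>
      refine le_trans (le_of_eq ?_)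
        ((abs_wzKernel_succ_le m k n hk (by omega) (by omega)).trans ih)
      push_cast
      ring
  have h0 : Tendsto (fun N : ℕ => C * (1 / ((N : ℝ) + 1))) atTop (𝓝 0) := by
    simpa using (tendsto_one_div_add_atTop_nhds_zero_nat (𝕜 := ℝ)).const_mul C
  refine squeeze_zero_norm' ?_ h0
  filter_upwards [eventually_ge_atTop (m + 1)] with n hn
  rw [Real.norm_eq_abs, abs_mul, Nat.abs_cast, mul_one_div, le_div_iff₀ (by positivity)]
  linarith [hC n hn]

theorem tendsto_sum_wzTerm_iff (m k : ℕ) (hk : 2 ≤ k) (L : ℝ) :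
    Tendsto (fun N => ∑ n ∈ range N, wzTerm m k n) atTop (𝓝 L) ↔
      Tendsto (fun N => ∑ n ∈ range N, wzTerm m 2 n) atTop (𝓝 L) := by
  induction k, hk using Nat.le_induction with
  | base => rfl
  | succ k hk ih =>
    rw [← ih]
    simp only [sum_wzTerm_succ_left]
    have h := tendsto_mul_wzKernel m k hk
    exact ⟨fun H => by simpa using H.sub h, fun H => by simpa using H.add h⟩

theorem tendsto_natCast_add_div_add (x y : ℝ) :
    Tendsto (fun k : ℕ => ((k : ℝ) + x) / (k + y)) atTop (𝓝 1) := by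
  simpa [add_comm] using tendsto_add_mul_div_add_mul_atTop_nhds x y 1 one_ne_zero

theorem tendsto_factorial_sq_div (m : ℕ) :
    Tendsto (fun k : ℕ => ((m + k).factorial : ℝ) ^ 2 / (k.factorial * (2 * m + k).factorial))
      atTop (𝓝 1) := by
  induction m with
  | zero =>
    refine tendsto_const_nhds.congr fun k => ?_
    simp only [Nat.mul_zero, zero_add]
    field_simp
  | succ m ih =>
    have h := (ih.mul (tendsto_natCast_add_div_add (m + 1) (2 * m + 1))).mul
      (tendsto_natCast_add_div_add (m + 1) (2 * m + 2))
    simp only [mul_one] at h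
    refine h.congr fun k => ?_
    rw [show m + 1 + k = m + k + 1 by ring, show 2 * (m + 1) + k = 2 * m + k + 1 + 1 by ring]
    simp only [Nat.factorial_succ]
    push_cast
    field_simp
    ring

theorem prod_wallis_eq (j : ℕ) :
    ∏ i ∈ range j, ((2 * i + 2 : ℝ) / (2 * i + 1) * ((2 * i + 2) / (2 * i + 3))) =
      (j.factorial : ℝ) ^ 2 / (risingFac (1 / 2) j ^ 2 * (2 * j + 1)) := by
  induction j with
  | zero => simp [risingFac]
  | succ j ih =>
    have := risingFac_pos (x := 1 / 2) (by norm_num) j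
    rw [prod_range_succ, ih, risingFac_succ, Nat.factorial_succ]
    push_cast
    have : (2 * ((j : ℝ) + 1) + 1) = 2 * j + 3 := by ring
    rw [this]
    field_simp
    ring

theorem wzTerm_zero (m k : ℕ) :
    wzTerm m k 0 = risingFac (1 / 2) (m + k) ^ 2 * (k + m + 1 / 2) /
      (k.factorial * (2 * m + k).factorial) := by
  have h := risingFac_add (1 / 2) m k
  rw [add_comm (1 / 2 : ℝ)] at h
  simp only [wzTerm, wzKernel, add_zero]
  rw [sq]
  nth_rewrite 3 [h]
  simp [risingFac, fallingFac]
  ring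

theorem tendsto_wzTerm_zero (m : ℕ) :
    Tendsto (fun k => wzTerm m k 0) atTop (𝓝 (1 / Real.pi)) := by
  have hW := Real.tendsto_prod_pi_div_two
  simp only [prod_wallis_eq] at hW
  have hW' := (hW.comp (tendsto_add_atTop_nat m)).inv₀ (by positivity)
  have h := (hW'.mul (tendsto_factorial_sq_div m)).const_mul (1 / 2)
  have e : 1 / 2 * ((Real.pi / 2)⁻¹ * 1) = 1 / Real.pi := by field_simp
  rw [e] at h
  refine h.congr fun k => ?_
  have := risingFac_pos (x := 1 / 2) (by norm_num) (m + k)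
  rw [wzTerm_zero]
  simp only [Function.comp, add_comm k m]
  push_cast
  field_simp
  ring

theorem wzTerm_succ_right (m k n : ℕ) :
    wzTerm m k (n + 1) = wzTerm m k n *
      (((m : ℝ) + n + 1 / 2) * (m - n - 1 / 2) / (n + 1) * (1 / (k + (n + 1))) *
        ((k + (m + n + 1 / 2)) / (k + (2 * m + n + 1))) *
        ((k + (m + 2 * n + 5 / 2)) / (k + (m + 2 * n + 1 / 2)))) := by
  unfold wzTerm
  rw [wzKernel_succ_right]
  push_cast
  field_simp
  ring

theorem tendsto_wzTerm (m n : ℕ) :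
    Tendsto (fun k => wzTerm m k n) atTop (𝓝 (if n = 0 then 1 / Real.pi else 0)) := by
  induction n with
  | zero => simpa using tendsto_wzTerm_zero m
  | succ n ih =>
    simp only [wzTerm_succ_right]
    have h0 : Tendsto (fun k : ℕ => 1 / ((k : ℝ) + (n + 1))) atTop (𝓝 0) :=
      tendsto_const_nhds.div_atTop
        (tendsto_atTop_add_const_right _ _ tendsto_natCast_atTop_atTop)
    simpa using ih.mul (((h0.const_mul (((m : ℝ) + n + 1 / 2) * (m - n - 1 / 2) / (n + 1))).mul
      (tendsto_natCast_add_div_add (m + n + 1 / 2) (2 * m + n + 1))).mul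
      (tendsto_natCast_add_div_add (m + 2 * n + 5 / 2) (m + 2 * n + 1 / 2)))

theorem abs_wzTerm_succ_le (m k n : ℕ) (hk : 6 * (m + 1) ^ 2 ≤ k) :
    |wzTerm m k (n + 1)| * ((n + 2) * (n + 3)) ≤ |wzTerm m k n| * ((n + 1) * (n + 2)) := by
  have hk' : 6 * ((m : ℝ) + 1) ^ 2 ≤ k := by exact_mod_cast hk
  have hm : (0 : ℝ) ≤ m := m.cast_nonneg
  have hn : (0 : ℝ) ≤ n := n.cast_nonneg
  have hk2 : (2 : ℝ) ≤ k := by nlinarith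
  rw [wzTerm_succ_right, abs_mul, mul_assoc]
  refine mul_le_mul_of_nonneg_left ?_ (abs_nonneg _)
  have h1 : ((k : ℝ) + (m + n + 1 / 2)) / (k + (2 * m + n + 1)) ≤ 1 := by
    rw [div_le_one (by positivity)]
    linarith
  have h2 : ((k : ℝ) + (m + 2 * n + 5 / 2)) / (k + (m + 2 * n + 1 / 2)) ≤ (n + 2) / (n + 1) := by
    rw [div_le_div_iff₀ (by positivity) (by positivity)]
    nlinarith
  have h3 : |((m : ℝ) + n + 1 / 2) * (m - n - 1 / 2)| ≤ (n + 1 + m) ^ 2 := by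
    rw [abs_le]
    constructor <;> nlinarith [mul_nonneg hm hn]
  have h4 : ((n : ℝ) + 1 + m) ^ 2 * ((n + 2) * (n + 3)) ≤ (n + 1) ^ 3 * (k + (n + 1)) := by
    refine le_trans ?_ (by gcongr :
      ((n : ℝ) + 1) ^ 3 * (6 * ((m : ℝ) + 1) ^ 2 + (n + 1)) ≤ (n + 1) ^ 3 * (k + (n + 1)))
    rw [← sub_nonneg]
    ring_nf
    positivity
  rw [abs_mul, abs_mul, abs_mul, abs_div,
    abs_of_nonneg (by positivity : (0 : ℝ) ≤ n + 1),
    abs_of_nonneg (by positivity : (0 : ℝ) ≤ 1 / ((k : ℝ) + (n + 1))),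
    abs_of_nonneg (by positivity :
      (0 : ℝ) ≤ ((k : ℝ) + (m + n + 1 / 2)) / (k + (2 * m + n + 1))),
    abs_of_nonneg (by positivity :
      (0 : ℝ) ≤ ((k : ℝ) + (m + 2 * n + 5 / 2)) / (k + (m + 2 * n + 1 / 2)))]
  calc _ ≤ ((n : ℝ) + 1 + m) ^ 2 / (n + 1) * (1 / (k + (n + 1))) * 1 * ((n + 2) / (n + 1))
        * ((n + 2) * (n + 3)) := by gcongr
    _ = ((n : ℝ) + 1 + m) ^ 2 * ((n + 2) * (n + 3)) * (n + 2) / ((n + 1) ^ 2 * (k + (n + 1))) := by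
        field_simp
    _ ≤ (n + 1) ^ 3 * (k + (n + 1)) * (n + 2) / ((n + 1) ^ 2 * (k + (n + 1))) := by gcongr
    _ = _ := by field_simp

theorem eventually_abs_wzTerm_le (m : ℕ) :
    ∀ᶠ k in atTop, ∀ n : ℕ, ‖wzTerm m k n‖ ≤ 2 * (1 / ((n : ℝ) + 1) ^ 2) := by
  have hπ : 1 / Real.pi < 1 := by
    rw [div_lt_one Real.pi_pos]
    linarith [Real.pi_gt_three]
  have hπ' : -1 < 1 / Real.pi := by linarith [one_div_pos.2 Real.pi_pos]
  filter_upwards [eventually_ge_atTop (6 * (m + 1) ^ 2),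
    (tendsto_wzTerm_zero m).eventually (Ioo_mem_nhds hπ' hπ)] with k hk h0 n
  have key : |wzTerm m k n| * (((n : ℝ) + 1) * (n + 2)) ≤ 2 := by
    induction n with
    | zero =>
      have := abs_lt.2 h0
      norm_num
      linarith
    | succ n ih =>
      refine le_trans (le_of_eq ?_) ((abs_wzTerm_succ_le m k n hk).trans ih)
      push_cast
      ring
  rw [Real.norm_eq_abs, mul_one_div, le_div_iff₀ (by positivity)]
  refine le_trans ?_ key
  gcongr
  nlinarith [(n.cast_nonneg : (0 : ℝ) ≤ n)]

theorem tendsto_sum_wzTerm (m k : ℕ) (hk : 2 ≤ k) :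
    Tendsto (fun N => ∑ n ∈ range N, wzTerm m k n) atTop (𝓝 (1 / Real.pi)) := by
  have hsum : Summable fun n : ℕ => 2 * (1 / ((n : ℝ) + 1) ^ 2) := by
    have := (summable_nat_add_iff 1).2 (Real.summable_one_div_nat_pow.2 one_lt_two)
    exact Summable.mul_left _ (by simpa using this)
  have hlim := tendsto_tsum_of_dominated_convergence hsum (tendsto_wzTerm m)
    (eventually_abs_wzTerm_le m)
  rw [tsum_ite_eq] at hlim
  obtain ⟨K, hK⟩ := eventually_atTop.1 (eventually_abs_wzTerm_le m)
  have hs : ∀ j ≥ K, Tendsto (fun N => ∑ n ∈ range N, wzTerm m j n) atTop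
      (𝓝 (∑' n, wzTerm m j n)) := fun j hj =>
    (Summable.of_norm_bounded hsum (hK j hj)).hasSum.tendsto_sum_nat
  have hconst : ∀ j ≥ max K 2, ∑' n, wzTerm m j n = ∑' n, wzTerm m (max K 2) n := fun j hj =>
    tendsto_nhds_unique
      ((tendsto_sum_wzTerm_iff m j (le_of_max_le_right hj) _).1 (hs j (le_of_max_le_left hj)))
      ((tendsto_sum_wzTerm_iff m _ (le_max_right _ _) _).1 (hs _ (le_max_left _ _)))
  have hval : ∑' n, wzTerm m (max K 2) n = 1 / Real.pi := by
    refine tendsto_nhds_unique (tendsto_const_nhds.congr' ?_) hlim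
    filter_upwards [eventually_ge_atTop (max K 2)] with j hj
    exact (hconst j hj).symm
  rw [tendsto_sum_wzTerm_iff m k hk, ← tendsto_sum_wzTerm_iff m _ (le_max_right K 2), ← hval]
  exact hs _ (le_max_left _ _)

theorem one_div_pi_family (m k : ℕ) (hk : 2 ≤ k) :
    ∃ S : ℝ, Filter.Tendsto
      (fun N : ℕ => ∑ n ∈ Finset.range N,
        risingFac ((m : ℝ) + 1 / 2) n * fallingFac ((m : ℝ) - 1 / 2) n
            * risingFac ((m : ℝ) + 1 / 2) (k + n) * ((k : ℝ) + m + 2 * n + 1 / 2) /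
          ((n.factorial : ℝ) * ((k + n).factorial : ℝ) * ((2 * m + k + n).factorial : ℝ)))
      Filter.atTop (nhds S) ∧
    1 / Real.pi =
      risingFac (1 / 2) (m + k) / 2 ^ (2 * m) * (((2 * m).factorial : ℝ) / (m.factorial : ℝ)) * S := by
  have hA := risingFac_pos (x := 1 / 2) (by norm_num) (m + k)
  have hB := risingFac_pos (x := 1 / 2) (by norm_num) m
  refine ⟨(risingFac (1 / 2) (m + k) * risingFac (1 / 2) m)⁻¹ * (1 / Real.pi), ?_, ?_⟩
  · refine ((tendsto_sum_wzTerm m k hk).const_mul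
      (risingFac (1 / 2) (m + k) * risingFac (1 / 2) m)⁻¹).congr fun N => ?_
    rw [mul_sum]
    refine sum_congr rfl fun n _ => ?_
    unfold wzTerm wzKernel
    field_simp
  · have h : risingFac (1 / 2) (m + k) / 2 ^ (2 * m) *
        (((2 * m).factorial : ℝ) / (m.factorial : ℝ)) =
        risingFac (1 / 2) (m + k) * risingFac (1 / 2) m := by
      rw [risingFac_half m]
      ring
    rw [h]
    field_simp
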